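/- Endpoint Fefferman–Stein inequality for the strong maximal operator with iterated majorant: there exists C > 0 such that for every weight w on ℝ², every locally integrable f, and every t > 0, w({x ∈ ℝ² : M_R f(x) > t}) ≤ C ∫_{ℝ²} (|f(x)|/t)(1 + log⁺(|f(x)|/t)) W(x) dx, where W = M_R M_Q w. -/

import Mathlib

open MeasureTheory Set
open scoped ENNReal

noncomputable section

/-- A cube (square) in the plane with sides parallel to the axes. -/
def IsCube2 (Q : Set (ℝ × ℝ)) : Prop :=
  ∃ a b r : ℝ, 0 < r ∧ Q = Ioo a (a + r) ×ˢ Ioo b (b + r)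

/-- A rectangle in the plane with sides parallel to the axes. -/
def IsRect2 (R : Set (ℝ × ℝ)) : Prop :=
  ∃ a₁ b₁ a₂ b₂ : ℝ, a₁ < b₁ ∧ a₂ < b₂ ∧ R = Ioo a₁ b₁ ×ˢ Ioo a₂ b₂

/-- The Hardy–Littlewood maximal operator over cubes in the plane. -/
def MHL2 (f : ℝ × ℝ → ℝ) (x : ℝ × ℝ) : ℝ≥0∞ :=
  ⨆ (Q : Set (ℝ × ℝ)) (_ : IsCube2 Q ∧ x ∈ Q),
    (∫⁻ y in Q, ENNReal.ofReal |f y|) / volume Q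

/-- The strong maximal operator over axes-parallel rectangles in the plane. -/
def MR2 (f : ℝ × ℝ → ℝ) (x : ℝ × ℝ) : ℝ≥0∞ :=
  ⨆ (R : Set (ℝ × ℝ)) (_ : IsRect2 R ∧ x ∈ R),
    (∫⁻ y in R, ENNReal.ofReal |f y|) / volume R

/-- The strong maximal operator acting on `ℝ≥0∞`-valued functions. -/
def MR2e (g : ℝ × ℝ → ℝ≥0∞) (x : ℝ × ℝ) : ℝ≥0∞ :=
  ⨆ (R : Set (ℝ × ℝ)) (_ : IsRect2 R ∧ x ∈ R),
    (∫⁻ y in R, g y) / volume R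

/-- The dyadic interval of generation `p.1` and index `p.2` in the dyadic grid translated by `s`. -/
def dyadicIco (s : ℝ) (p : ℤ × ℤ) : Set ℝ :=
  {y | ⌊(y - s) / 2 ^ p.1⌋ = p.2}

theorem dyadicIco_eq (s : ℝ) (p : ℤ × ℤ) :
    dyadicIco s p = Ico (s + p.2 * 2 ^ p.1) (s + p.2 * 2 ^ p.1 + 2 ^ p.1) := by
  have h2 : (0 : ℝ) < 2 ^ p.1 := by positivity
  ext y
  simp only [dyadicIco, mem_ofPred_eq, mem_Ico, Int.floor_eq_iff, le_div_iff₀ h2, div_lt_iff₀ h2]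
  constructor <;> rintro ⟨h, h'⟩ <;> constructor <;> linarith

theorem volume_dyadicIco (s : ℝ) (p : ℤ × ℤ) :
    volume (dyadicIco s p) = ENNReal.ofReal (2 ^ p.1) := by
  rw [dyadicIco_eq, Real.volume_Ico]
  congr 1
  ring

theorem volume_dyadicIco_ne_zero (s : ℝ) (p : ℤ × ℤ) : volume (dyadicIco s p) ≠ 0 := by
  rw [volume_dyadicIco]
  have h2 : (0 : ℝ) < 2 ^ p.1 := by positivity
  simpa using h2

theorem volume_dyadicIco_ne_top (s : ℝ) (p : ℤ × ℤ) : volume (dyadicIco s p) ≠ ⊤ := by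
  rw [volume_dyadicIco]
  exact ENNReal.ofReal_ne_top

theorem measurableSet_dyadicIco (s : ℝ) (p : ℤ × ℤ) : MeasurableSet (dyadicIco s p) := by
  rw [dyadicIco_eq]
  exact measurableSet_Ico

theorem dyadicIco_subset_of_mem {s : ℝ} {p q : ℤ × ℤ} (h : p.1 ≤ q.1) {y : ℝ}
    (hp : y ∈ dyadicIco s p) (hq : y ∈ dyadicIco s q) : dyadicIco s p ⊆ dyadicIco s q := by
  obtain ⟨n, hn⟩ := Int.le.dest h
  have key : ∀ z : ℝ, ⌊(z - s) / 2 ^ q.1⌋ = ⌊(z - s) / 2 ^ p.1⌋ / ((2 ^ n : ℕ) : ℤ) := by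
    intro z
    rw [← Int.floor_div_natCast, ← hn, zpow_add₀ two_ne_zero, zpow_natCast, div_div]
    push_cast
    rfl
  intro z hz
  simp only [dyadicIco, mem_ofPred_eq] at *
  rw [key] at hq ⊢
  rw [hz, ← hp, hq]

theorem dyadicIco_subset_or_disjoint {s : ℝ} {p q : ℤ × ℤ} (h : p.1 ≤ q.1) :
    dyadicIco s p ⊆ dyadicIco s q ∨ Disjoint (dyadicIco s p) (dyadicIco s q) := by
  by_cases hd : Disjoint (dyadicIco s p) (dyadicIco s q)
  · exact Or.inr hd
  · obtain ⟨y, hp, hq⟩ := Set.not_disjoint_iff.1 hd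
    exact Or.inl (dyadicIco_subset_of_mem h hp hq)

/-- The dyadic rectangle with sides `dyadicIco s.1 p.1` and `dyadicIco s.2 p.2`. -/
def dyadicRect (s : ℝ × ℝ) (p : (ℤ × ℤ) × (ℤ × ℤ)) : Set (ℝ × ℝ) :=
  dyadicIco s.1 p.1 ×ˢ dyadicIco s.2 p.2

theorem measurableSet_dyadicRect (s : ℝ × ℝ) (p : (ℤ × ℤ) × (ℤ × ℤ)) :
    MeasurableSet (dyadicRect s p) :=
  (measurableSet_dyadicIco _ _).prod (measurableSet_dyadicIco _ _)

theorem volume_dyadicRect (s : ℝ × ℝ) (p : (ℤ × ℤ) × (ℤ × ℤ)) :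
    volume (dyadicRect s p) = volume (dyadicIco s.1 p.1) * volume (dyadicIco s.2 p.2) := by
  rw [dyadicRect, Measure.volume_eq_prod, Measure.prod_prod]

theorem volume_dyadicRect_ne_zero (s : ℝ × ℝ) (p : (ℤ × ℤ) × (ℤ × ℤ)) :
    volume (dyadicRect s p) ≠ 0 := by
  rw [volume_dyadicRect]
  exact mul_ne_zero (volume_dyadicIco_ne_zero _ _) (volume_dyadicIco_ne_zero _ _)

theorem volume_dyadicRect_ne_top (s : ℝ × ℝ) (p : (ℤ × ℤ) × (ℤ × ℤ)) :
    volume (dyadicRect s p) ≠ ⊤ := by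
  rw [volume_dyadicRect]
  exact ENNReal.mul_ne_top (volume_dyadicIco_ne_top _ _) (volume_dyadicIco_ne_top _ _)

/-- The union of the second sides of the rectangles in `L` whose first side contains that of `p`. -/
def crossing (s : ℝ × ℝ) (p : (ℤ × ℤ) × (ℤ × ℤ)) (L : List ((ℤ × ℤ) × (ℤ × ℤ))) : Set ℝ :=
  {y | ∃ q ∈ L, dyadicIco s.1 p.1 ⊆ dyadicIco s.1 q.1 ∧ y ∈ dyadicIco s.2 q.2}

/-- A list of dyadic rectangles, the most recently selected first, with first sides of decreasing
length in order of selection and such that at most half of each second side is covered by the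
crossing rectangles selected before. -/
def IsSparseList (s : ℝ × ℝ) : List ((ℤ × ℤ) × (ℤ × ℤ)) → Prop
  | [] => True
  | p :: L => IsSparseList s L ∧
      2 * volume (dyadicIco s.2 p.2 ∩ crossing s p L) ≤ volume (dyadicIco s.2 p.2) ∧
      ∀ q ∈ L, p.1.1 ≤ q.1.1

theorem crossing_mono (s : ℝ × ℝ) (p : (ℤ × ℤ) × (ℤ × ℤ)) {L L' : List ((ℤ × ℤ) × (ℤ × ℤ))}
    (h : L ⊆ L') : crossing s p L ⊆ crossing s p L' :=
  fun _ ⟨q, hq, hy⟩ => ⟨q, h hq, hy⟩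

theorem exists_isSparseList (s : ℝ × ℝ) (l : List ((ℤ × ℤ) × (ℤ × ℤ)))
    (hl : l.Pairwise fun p q => p.1.1 ≤ q.1.1) :
    ∃ L, IsSparseList s L ∧ L ⊆ l ∧ ∀ p ∈ l,
      volume (dyadicIco s.2 p.2) ≤ 2 * volume (dyadicIco s.2 p.2 ∩ crossing s p L) := by
  induction l with
  | nil => exact ⟨[], trivial, by simp, by simp⟩
  | cons p l ih =>
    rw [List.pairwise_cons] at hl
    obtain ⟨L, hL, hLl, hcov⟩ := ih hl.2
    rcases le_total (2 * volume (dyadicIco s.2 p.2 ∩ crossing s p L))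
      (volume (dyadicIco s.2 p.2)) with h | h
    · refine ⟨p :: L, ⟨hL, h, fun q hq => hl.1 q (hLl hq)⟩, List.cons_subset_cons _ hLl, ?_⟩
      intro q hq
      rcases List.mem_cons.1 hq with rfl | hq
      · have : dyadicIco s.2 q.2 ∩ crossing s q (q :: L) = dyadicIco s.2 q.2 :=
          inter_eq_left.2 fun y hy => ⟨q, by simp, Subset.rfl, hy⟩
        rw [this, two_mul]
        exact le_self_add
      · refine (hcov q hq).trans ?_
        gcongr
        exact crossing_mono s q (List.subset_cons_self _ _)
    · refine ⟨L, hL, fun q hq => List.mem_cons_of_mem _ (hLl hq), ?_⟩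
      intro q hq
      rcases List.mem_cons.1 hq with rfl | hq
      · exact h
      · exact hcov q hq

/-- The number of rectangles in `L` containing `x`. -/
def overlap (s : ℝ × ℝ) : List ((ℤ × ℤ) × (ℤ × ℤ)) → ℝ × ℝ → ℕ
  | [], _ => 0
  | p :: L, x => (dyadicRect s p).indicator 1 x + overlap s L x

theorem measurable_overlap (s : ℝ × ℝ) (L : List ((ℤ × ℤ) × (ℤ × ℤ))) :
    Measurable (overlap s L) := by
  induction L with
  | nil => exact measurable_const
  | cons p L ih =>
    exact (measurable_one.indicator (measurableSet_dyadicRect s p)).add ih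

/-- The slice over the abscissa `a` of the union of the rectangles in `L`. -/
def slice (s : ℝ × ℝ) (L : List ((ℤ × ℤ) × (ℤ × ℤ))) (a : ℝ) : Set ℝ :=
  {y | ∃ q ∈ L, (a, y) ∈ dyadicRect s q}

theorem measurableSet_slice (s : ℝ × ℝ) (L : List ((ℤ × ℤ) × (ℤ × ℤ))) (a : ℝ) :
    MeasurableSet (slice s L a) := by
  have : slice s L a = ⋃ q ∈ {q | q ∈ L}, Prod.mk a ⁻¹' dyadicRect s q := by
    ext y
    simp [slice]
  rw [this]
  exact L.finite_toSet.measurableSet_biUnion fun q _ =>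
    measurable_prodMk_left (measurableSet_dyadicRect s q)

theorem overlap_cons_of_mem {s : ℝ × ℝ} {p : (ℤ × ℤ) × (ℤ × ℤ)}
    (L : List ((ℤ × ℤ) × (ℤ × ℤ))) {x : ℝ × ℝ} (hx : x ∈ dyadicRect s p) :
    overlap s (p :: L) x = overlap s L x + 1 := by
  simp [overlap, hx, add_comm]

theorem overlap_cons_of_notMem {s : ℝ × ℝ} {p : (ℤ × ℤ) × (ℤ × ℤ)}
    (L : List ((ℤ × ℤ) × (ℤ × ℤ))) {x : ℝ × ℝ} (hx : x ∉ dyadicRect s p) :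
    overlap s (p :: L) x = overlap s L x := by
  simp [overlap, hx]

theorem overlap_eq_zero {s : ℝ × ℝ} {L : List ((ℤ × ℤ) × (ℤ × ℤ))} {a y : ℝ}
    (hy : y ∉ slice s L a) : overlap s L (a, y) = 0 := by
  induction L with
  | nil => rfl
  | cons p L ih =>
    rw [overlap_cons_of_notMem]
    · exact ih fun ⟨q, hq, h⟩ => hy ⟨q, List.mem_cons_of_mem _ hq, h⟩
    · exact fun h => hy ⟨p, by simp, h⟩

theorem IsSparseList.subset_or_disjoint {s : ℝ × ℝ} {p : (ℤ × ℤ) × (ℤ × ℤ)}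
    {L : List ((ℤ × ℤ) × (ℤ × ℤ))} (h : IsSparseList s (p :: L)) {a : ℝ}
    (ha : a ∈ dyadicIco s.1 p.1) {q : (ℤ × ℤ) × (ℤ × ℤ)} (hq : q ∈ L)
    (haq : a ∈ dyadicIco s.1 q.1) :
    dyadicIco s.2 q.2 ⊆ dyadicIco s.2 p.2 ∨
      Disjoint (dyadicIco s.2 q.2) (dyadicIco s.2 p.2) := by
  rcases le_total q.2.1 p.2.1 with hl | hl
  · exact dyadicIco_subset_or_disjoint hl
  rcases dyadicIco_subset_or_disjoint (s := s.2) hl with hs | hd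
  · exfalso
    have hI := dyadicIco_subset_of_mem (h.2.2 q hq) ha haq
    have h1 : dyadicIco s.2 p.2 ∩ crossing s p L = dyadicIco s.2 p.2 :=
      inter_eq_left.2 fun y hy => ⟨q, hq, hI, hs hy⟩
    have h2 := h.2.1
    rw [h1, two_mul] at h2
    exact (ENNReal.lt_add_right (volume_dyadicIco_ne_top _ _)
      (volume_dyadicIco_ne_zero s.2 p.2)).not_ge h2
  · exact Or.inr hd.symm

theorem lintegral_overlap_cons_le {s : ℝ × ℝ} {p : (ℤ × ℤ) × (ℤ × ℤ)}
    {L : List ((ℤ × ℤ) × (ℤ × ℤ))} (h : IsSparseList s (p :: L)) {a : ℝ}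
    (ha : a ∈ dyadicIco s.1 p.1)
    (ih : ∫⁻ y in dyadicIco s.2 p.2 ∩ slice s L a, (3 / 2 : ℝ≥0∞) ^ overlap s L (a, y) ≤
      3 * volume (dyadicIco s.2 p.2 ∩ slice s L a)) :
    ∫⁻ y in dyadicIco s.2 p.2, (3 / 2 : ℝ≥0∞) ^ overlap s (p :: L) (a, y) ≤
      3 * volume (dyadicIco s.2 p.2) := by
  set J := dyadicIco s.2 p.2 with hJ
  set G := slice s L a with hG
  have hJm : MeasurableSet J := measurableSet_dyadicIco _ _
  have hGm : MeasurableSet G := measurableSet_slice _ _ _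
  have hsp : 2 * volume (J ∩ G) ≤ volume J := by
    refine le_trans ?_ h.2.1
    gcongr
    rintro y ⟨q, hq, hy⟩
    exact ⟨q, hq, dyadicIco_subset_of_mem (h.2.2 q hq) ha hy.1, hy.2⟩
  have hsplit : volume (J ∩ G) + volume (J \ G) = volume J := measure_inter_add_sdiff J hGm
  have h1 : ∫⁻ y in J, (3 / 2 : ℝ≥0∞) ^ overlap s (p :: L) (a, y) =
      ∫⁻ y in J, (3 / 2 : ℝ≥0∞) * (3 / 2 : ℝ≥0∞) ^ overlap s L (a, y) := by
    refine setLIntegral_congr_fun hJm fun y hy => ?_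
    rw [overlap_cons_of_mem L (show (a, y) ∈ dyadicRect s p from ⟨ha, hy⟩), pow_succ']
  have h2 : ∫⁻ y in J \ G, (3 / 2 : ℝ≥0∞) ^ overlap s L (a, y) = volume (J \ G) := by
    rw [← setLIntegral_one]
    refine setLIntegral_congr_fun (hJm.diff hGm) fun y hy => ?_
    rw [overlap_eq_zero hy.2, pow_zero]
  rw [h1, lintegral_const_mul' _ _ (by finiteness), ← lintegral_inter_add_sdiff _ J hGm, h2]
  calc (3 / 2 : ℝ≥0∞) * ((∫⁻ y in J ∩ G, (3 / 2 : ℝ≥0∞) ^ overlap s L (a, y)) + volume (J \ G))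
      ≤ (3 / 2 : ℝ≥0∞) * (3 * volume (J ∩ G) + volume (J \ G)) := by gcongr
    _ = (3 / 2 : ℝ≥0∞) * (2 * volume (J ∩ G) + volume J) := by
        rw [← hsplit]; ring
    _ ≤ (3 / 2 : ℝ≥0∞) * (volume J + volume J) := by gcongr
    _ = 3 * volume J := by
        rw [← two_mul, ← mul_assoc, ENNReal.div_mul_cancel (by norm_num) (by norm_num)]

theorem lintegral_overlap_inter_slice_le {s : ℝ × ℝ} {L : List ((ℤ × ℤ) × (ℤ × ℤ))}
    (h : IsSparseList s L) (a : ℝ) (E : Set ℝ) (hE : MeasurableSet E)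
    (hLE : ∀ q ∈ L, a ∈ dyadicIco s.1 q.1 →
      dyadicIco s.2 q.2 ⊆ E ∨ Disjoint (dyadicIco s.2 q.2) E) :
    ∫⁻ y in E ∩ slice s L a, (3 / 2 : ℝ≥0∞) ^ overlap s L (a, y) ≤
      3 * volume (E ∩ slice s L a) := by
  induction L generalizing E with
  | nil => simp [slice]
  | cons p L ih =>
    have hLE' := fun q hq => hLE q (List.mem_cons_of_mem _ hq)
    have hGm := measurableSet_slice s L a
    by_cases hskip : a ∈ dyadicIco s.1 p.1 ∧ dyadicIco s.2 p.2 ⊆ E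
    · obtain ⟨ha, hJE⟩ := hskip
      have hJm := measurableSet_dyadicIco s.2 p.2
      have hset : E ∩ slice s (p :: L) a =
          ((E \ dyadicIco s.2 p.2) ∩ slice s L a) ∪ dyadicIco s.2 p.2 := by
        ext y
        simp only [slice, dyadicRect, List.mem_cons, mem_inter_iff, mem_ofPred_eq, mem_union,
          mem_sdiff, mem_prod, exists_eq_or_imp]
        by_cases hy : y ∈ dyadicIco s.2 p.2
        · simp [hy, ha, hJE hy]
        · simp [hy]
      have hdisj : Disjoint ((E \ dyadicIco s.2 p.2) ∩ slice s L a) (dyadicIco s.2 p.2) :=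
        disjoint_sdiff_left.mono_left inter_subset_left
      rw [hset, measure_union hdisj hJm, mul_add]
      refine (lintegral_union_le _ _ _).trans (add_le_add ?_ ?_)
      · refine le_trans (le_of_eq ?_) (ih h.1 (E \ dyadicIco s.2 p.2) (hE.diff hJm) ?_)
        · refine setLIntegral_congr_fun ((hE.diff hJm).inter hGm) fun y hy => ?_
          rw [overlap_cons_of_notMem]
          exact fun hy' => hy.1.2 hy'.2
        · intro q hq haq
          rcases h.subset_or_disjoint ha hq haq with h1 | h1
          · exact Or.inr (disjoint_sdiff_right.mono_left h1)
          · rcases hLE' q hq haq with h2 | h2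
            · exact Or.inl fun y hy => ⟨h2 hy, fun hy' => h1.le_bot ⟨hy, hy'⟩⟩
            · exact Or.inr (h2.mono_right sdiff_subset)
      · exact lintegral_overlap_cons_le h ha
          (ih h.1 _ hJm fun q hq haq => h.subset_or_disjoint ha hq haq)
    · have hne : ∀ y ∈ E, (a, y) ∉ dyadicRect s p := by
        intro y hy hmem
        rcases hLE p (by simp) hmem.1 with h1 | h1
        · exact hskip ⟨hmem.1, h1⟩
        · exact h1.le_bot ⟨hmem.2, hy⟩
      have hset : E ∩ slice s (p :: L) a = E ∩ slice s L a := by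
        ext y
        simp only [slice, List.mem_cons, mem_inter_iff, mem_ofPred_eq, exists_eq_or_imp]
        have := hne y
        tauto
      rw [hset]
      refine le_trans (le_of_eq ?_) (ih h.1 E hE hLE')
      refine setLIntegral_congr_fun (hE.inter hGm) fun y hy => ?_
      rw [overlap_cons_of_notMem L (hne y hy.1)]

theorem lintegral_overlap_le {s : ℝ × ℝ} {p : (ℤ × ℤ) × (ℤ × ℤ)}
    {L : List ((ℤ × ℤ) × (ℤ × ℤ))} (h : IsSparseList s (p :: L)) :
    ∫⁻ x in dyadicRect s p, (3 / 2 : ℝ≥0∞) ^ overlap s (p :: L) x ≤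
      3 * volume (dyadicRect s p) := by
  have hm : Measurable fun x => (3 / 2 : ℝ≥0∞) ^ overlap s (p :: L) x :=
    (measurable_from_nat (f := fun n => (3 / 2 : ℝ≥0∞) ^ n)).comp (measurable_overlap s _)
  rw [volume_dyadicRect, dyadicRect, Measure.volume_eq_prod, setLIntegral_prod _ hm.aemeasurable]
  calc _ ≤ ∫⁻ _ in dyadicIco s.1 p.1, 3 * volume (dyadicIco s.2 p.2) := by
        refine setLIntegral_mono' (measurableSet_dyadicIco _ _) fun a ha => ?_
        exact lintegral_overlap_cons_le h ha (lintegral_overlap_inter_slice_le h.1 a _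
          (measurableSet_dyadicIco _ _) fun q hq haq => h.subset_or_disjoint ha hq haq)
    _ = _ := by rw [setLIntegral_const]; ring
theorem setLIntegral_biUnion_le_of_finset {α ι : Type*} [MeasurableSpace α] {μ : Measure α}
    {T : Set ι} (hT : T.Countable) (s : ι → Set α) (f : α → ℝ≥0∞) (C : ℝ≥0∞)
    (h : ∀ F : Finset ι, ↑F ⊆ T → ∫⁻ x in ⋃ i ∈ F, s i, f x ∂μ ≤ C) :
    ∫⁻ x in ⋃ i ∈ T, s i, f x ∂μ ≤ C := by
  classical
  have : Countable T := hT
  have hU : ⋃ i ∈ T, s i = ⋃ F : Finset T, ⋃ i ∈ F, s i := by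
    ext x
    simp only [mem_iUnion, exists_prop]
    constructor
    · rintro ⟨i, hi, hx⟩
      exact ⟨{⟨i, hi⟩}, ⟨i, hi⟩, by simp, hx⟩
    · rintro ⟨F, i, -, hx⟩
      exact ⟨i, i.2, hx⟩
  rw [hU, setLIntegral_iUnion_of_directed]
  · refine iSup_le fun F => ?_
    have hF : ⋃ i ∈ F, s i = ⋃ i ∈ F.image Subtype.val, s i := by simp
    rw [hF]
    exact h _ (by simp)
  · refine directed_of_isDirected_le fun F G hFG => ?_
    exact biUnion_subset_biUnion_left hFG

theorem dyadicSquare_subset_of_mem {s : ℝ × ℝ} {p q : (ℤ × ℤ) × (ℤ × ℤ)} (hp : p.1.1 = p.2.1)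
    (hq : q.1.1 = q.2.1) (h : p.1.1 ≤ q.1.1) {x : ℝ × ℝ} (hxp : x ∈ dyadicRect s p)
    (hxq : x ∈ dyadicRect s q) : dyadicRect s p ⊆ dyadicRect s q :=
  prod_mono (dyadicIco_subset_of_mem h hxp.1 hxq.1)
    (dyadicIco_subset_of_mem (hp ▸ hq ▸ h) hxp.2 hxq.2)

/-- A dyadic Fefferman–Stein inequality: `v` majorizes the dyadic maximal function of `w`. -/
theorem setLIntegral_dyadicSquare_le {s : ℝ × ℝ} {w v : ℝ × ℝ → ℝ≥0∞} {E : Set (ℝ × ℝ)}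
    (hE : MeasurableSet E)
    (hwv : ∀ q : (ℤ × ℤ) × (ℤ × ℤ), q.1.1 = q.2.1 → ∀ x ∈ dyadicRect s q,
      ∫⁻ y in dyadicRect s q, w y ≤ 4 * volume (dyadicRect s q) * v x) :
    ∫⁻ x in ⋃ q ∈ {q : (ℤ × ℤ) × (ℤ × ℤ) | q.1.1 = q.2.1 ∧
      volume (dyadicRect s q) ≤ 2 * volume (dyadicRect s q ∩ E)}, dyadicRect s q, w x ≤
      8 * ∫⁻ x in E, v x := by
  classical
  refine setLIntegral_biUnion_le_of_finset (Set.to_countable _) _ _ _ fun F hF => ?_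
  set 𝒬 : Finset (Set (ℝ × ℝ)) := F.image (dyadicRect s) with h𝒬
  set 𝓜 : Finset (Set (ℝ × ℝ)) := {Q ∈ 𝒬 | Maximal (· ∈ 𝒬) Q} with h𝓜
  have hsub : ⋃ q ∈ F, dyadicRect s q ⊆ ⋃ Q ∈ 𝓜, Q := by
    refine iUnion₂_subset fun q hq => ?_
    obtain ⟨M, hqM, hM⟩ := 𝒬.exists_le_maximal (Finset.mem_image_of_mem (dyadicRect s) hq)
    exact subset_trans hqM (subset_biUnion_of_mem (u := id)
      (show M ∈ 𝓜 from Finset.mem_filter.2 ⟨hM.1, hM⟩))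
  have hdisj : (𝓜 : Set (Set (ℝ × ℝ))).PairwiseDisjoint id := by
    intro P hP Q hQ hPQ
    by_contra hnd
    obtain ⟨x, hxP, hxQ⟩ := Set.not_disjoint_iff.1 hnd
    have hP' := (Finset.mem_filter.1 hP).2
    have hQ' := (Finset.mem_filter.1 hQ).2
    obtain ⟨p, hp, rfl⟩ := Finset.mem_image.1 hP'.1
    obtain ⟨q, hq, rfl⟩ := Finset.mem_image.1 hQ'.1
    rcases le_total p.1.1 q.1.1 with h | h
    · exact hPQ (hP'.eq_of_le hQ'.1
        (dyadicSquare_subset_of_mem (hF hp).1 (hF hq).1 h hxP hxQ))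
    · exact hPQ (hQ'.eq_of_le hP'.1
        (dyadicSquare_subset_of_mem (hF hq).1 (hF hp).1 h hxQ hxP)).symm
  have hmeas : ∀ Q ∈ 𝓜, MeasurableSet Q := by
    intro Q hQ
    obtain ⟨q, -, rfl⟩ := Finset.mem_image.1 (Finset.mem_filter.1 hQ).1
    exact measurableSet_dyadicRect s q
  calc ∫⁻ x in ⋃ q ∈ F, dyadicRect s q, w x
      ≤ ∫⁻ x in ⋃ Q ∈ 𝓜, Q, w x := lintegral_mono_set hsub
    _ = ∑ Q ∈ 𝓜, ∫⁻ x in Q, w x := lintegral_biUnion_finset hdisj hmeas w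
    _ ≤ ∑ Q ∈ 𝓜, 8 * ∫⁻ x in Q ∩ E, v x := by
        refine Finset.sum_le_sum fun Q hQ => ?_
        obtain ⟨q, hq, rfl⟩ := Finset.mem_image.1 (Finset.mem_filter.1 hQ).1
        have h0 := volume_dyadicRect_ne_zero s q
        have ht := volume_dyadicRect_ne_top s q
        set A := (∫⁻ y in dyadicRect s q, w y) / volume (dyadicRect s q) with hA
        have hAv : ∀ x ∈ dyadicRect s q ∩ E, A ≤ 4 * v x := fun x hx => by
          refine ENNReal.div_le_of_le_mul ?_
          refine (hwv q (hF hq).1 x hx.1).trans (le_of_eq ?_)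
          ring
        calc ∫⁻ y in dyadicRect s q, w y = A * volume (dyadicRect s q) :=
              (ENNReal.div_mul_cancel h0 ht).symm
          _ ≤ A * (2 * volume (dyadicRect s q ∩ E)) := by
              gcongr
              exact (hF hq).2
          _ = 2 * ∫⁻ _ in dyadicRect s q ∩ E, A := by rw [setLIntegral_const]; ring
          _ ≤ 2 * ∫⁻ x in dyadicRect s q ∩ E, 4 * v x := by
              gcongr 2 * ?_
              exact setLIntegral_mono' ((measurableSet_dyadicRect s q).inter hE) hAv
          _ = 8 * ∫⁻ x in dyadicRect s q ∩ E, v x := by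
              rw [lintegral_const_mul' _ _ (by finiteness), ← mul_assoc]
              norm_num
    _ = 8 * ∫⁻ x in ⋃ Q ∈ 𝓜, Q ∩ E, v x := by
        rw [lintegral_biUnion_finset, Finset.mul_sum]
        · exact hdisj.mono fun Q => inter_subset_left
        · exact fun Q hQ => (hmeas Q hQ).inter hE
    _ ≤ 8 * ∫⁻ x in E, v x := by
        gcongr 8 * ?_
        exact lintegral_mono_set (iUnion₂_subset fun _ _ => inter_subset_right)

/-- The sum of `c p` over the rectangles `p` in `L` containing `x`. -/
def coeffSum (s : ℝ × ℝ) (c : (ℤ × ℤ) × (ℤ × ℤ) → ℝ≥0∞) :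
    List ((ℤ × ℤ) × (ℤ × ℤ)) → ℝ × ℝ → ℝ≥0∞
  | [], _ => 0
  | p :: L, x => (dyadicRect s p).indicator (fun _ => c p) x + coeffSum s c L x

/-- The sum of `c p` over the rectangles `p` in `L` containing `x`, each term being multiplied by
a quantity growing exponentially with the number of rectangles met so far. -/
def coeffPowSum (s : ℝ × ℝ) (c : (ℤ × ℤ) × (ℤ × ℤ) → ℝ≥0∞) :
    List ((ℤ × ℤ) × (ℤ × ℤ)) → ℝ × ℝ → ℝ≥0∞
  | [], _ => 0
  | p :: L, x => (dyadicRect s p).indicator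
      (fun y => c p * (3 / 2 : ℝ≥0∞) ^ overlap s (p :: L) y) x + coeffPowSum s c L x

theorem measurable_pow_overlap (s : ℝ × ℝ) (L : List ((ℤ × ℤ) × (ℤ × ℤ))) :
    Measurable fun x => (3 / 2 : ℝ≥0∞) ^ overlap s L x :=
  (measurable_from_nat (f := fun n => (3 / 2 : ℝ≥0∞) ^ n)).comp (measurable_overlap s _)

theorem measurable_coeffPowSum_head (s : ℝ × ℝ) (c : ℝ≥0∞) (p : (ℤ × ℤ) × (ℤ × ℤ))
    (L : List ((ℤ × ℤ) × (ℤ × ℤ))) : Measurable ((dyadicRect s p).indicator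
      fun y => c * (3 / 2 : ℝ≥0∞) ^ overlap s L y) :=
  ((measurable_pow_overlap s L).const_mul c).indicator (measurableSet_dyadicRect s p)

theorem measurable_coeffPowSum (s : ℝ × ℝ) (c : (ℤ × ℤ) × (ℤ × ℤ) → ℝ≥0∞)
    (L : List ((ℤ × ℤ) × (ℤ × ℤ))) : Measurable (coeffPowSum s c L) := by
  induction L with
  | nil => exact measurable_const
  | cons p L ih => exact (measurable_coeffPowSum_head s (c p) p (p :: L)).add ih

theorem lintegral_coeffPowSum_le {s : ℝ × ℝ} (c : (ℤ × ℤ) × (ℤ × ℤ) → ℝ≥0∞)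
    {L : List ((ℤ × ℤ) × (ℤ × ℤ))} (h : IsSparseList s L) :
    ∫⁻ x, coeffPowSum s c L x ≤ 3 * (L.map fun q => c q * volume (dyadicRect s q)).sum := by
  induction L with
  | nil => simp [coeffPowSum]
  | cons p L ih =>
    simp only [coeffPowSum, List.map_cons, List.sum_cons, mul_add]
    rw [lintegral_add_left (measurable_coeffPowSum_head s (c p) p (p :: L)),
      lintegral_indicator (measurableSet_dyadicRect s p),
      lintegral_const_mul _ (measurable_pow_overlap s _)]
    refine add_le_add ?_ (ih h.1)
    calc _ ≤ c p * (3 * volume (dyadicRect s p)) := by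
          gcongr
          exact lintegral_overlap_le h
      _ = _ := by ring

theorem sum_coeff_mul_volume_le {s : ℝ × ℝ} (c : (ℤ × ℤ) × (ℤ × ℤ) → ℝ≥0∞)
    (g : ℝ × ℝ → ℝ≥0∞) (L : List ((ℤ × ℤ) × (ℤ × ℤ)))
    (h : ∀ q ∈ L, volume (dyadicRect s q) ≤ ∫⁻ x in dyadicRect s q, g x) :
    (L.map fun q => c q * volume (dyadicRect s q)).sum ≤ ∫⁻ x, g x * coeffSum s c L x := by
  induction L with
  | nil => simp
  | cons p L ih =>
    simp only [coeffSum, List.map_cons, List.sum_cons, mul_add]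
    refine le_trans (add_le_add ?_ (ih fun q hq => h q (List.mem_cons_of_mem _ hq)))
      (le_lintegral_add _ _)
    calc c p * volume (dyadicRect s p) ≤ c p * ∫⁻ x in dyadicRect s p, g x := by
          gcongr
          exact h p (by simp)
      _ ≤ ∫⁻ x in dyadicRect s p, c p * g x := lintegral_const_mul_le _ _
      _ = ∫⁻ x, (dyadicRect s p).indicator (fun x => c p * g x) x :=
          (lintegral_indicator (measurableSet_dyadicRect s p) _).symm
      _ = _ := by
          refine lintegral_congr fun x => ?_
          by_cases hx : x ∈ dyadicRect s p <;> simp [hx, mul_comm]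

theorem mul_coeffSum_le {s : ℝ × ℝ} (c : (ℤ × ℤ) × (ℤ × ℤ) → ℝ≥0∞) {x : ℝ × ℝ}
    {G W : ℝ≥0∞} {K : ℕ} (hK : ∀ n : ℕ, (3 / 2 : ℝ≥0∞) ^ n < 6 * G → n ≤ K)
    (L : List ((ℤ × ℤ) × (ℤ × ℤ))) (hc : ∀ q ∈ L, x ∈ dyadicRect s q → c q ≤ 4 * W) :
    G * coeffSum s c L x ≤ 1 / 6 * coeffPowSum s c L x +
      4 * W * G * (min (overlap s L x) K : ℕ) := by
  induction L with
  | nil => simp [coeffSum]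
  | cons p L ih =>
    have ih' := ih fun q hq => hc q (List.mem_cons_of_mem _ hq)
    by_cases hx : x ∈ dyadicRect s p
    · simp only [coeffSum, coeffPowSum, indicator_of_mem hx]
      set N := overlap s (p :: L) x with hN
      have hN' : N = overlap s L x + 1 := overlap_cons_of_mem L hx
      rw [mul_add, mul_add]
      by_cases hbig : (3 / 2 : ℝ≥0∞) ^ N < 6 * G
      · have hNK := hK N hbig
        have hmin : min N K = min (overlap s L x) K + 1 := by omega
        rw [hmin, Nat.cast_add, Nat.cast_one, mul_add, mul_one]
        calc G * c p + G * coeffSum s c L x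
            ≤ 4 * W * G + (1 / 6 * coeffPowSum s c L x +
              4 * W * G * (min (overlap s L x) K : ℕ)) := by
              refine add_le_add ?_ ih'
              rw [mul_comm]
              gcongr
              exact hc p (by simp) hx
          _ ≤ 1 / 6 * (c p * (3 / 2) ^ N) + (4 * W * G + (1 / 6 * coeffPowSum s c L x +
              4 * W * G * (min (overlap s L x) K : ℕ))) := le_add_self
          _ = _ := by ring
      · rw [add_assoc]
        refine add_le_add ?_ (ih'.trans ?_)
        · calc G * c p = 1 / 6 * (c p * (6 * G)) := by
                rw [show (1 / 6 : ℝ≥0∞) * (c p * (6 * G)) = (1 / 6 * 6) * (G * c p) by ring,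
                  ENNReal.div_mul_cancel (by norm_num) (by norm_num), one_mul]
            _ ≤ _ := by
                gcongr
                exact not_lt.1 hbig
        · gcongr
          omega
    · simpa [coeffSum, coeffPowSum, hx, overlap_cons_of_notMem L hx] using ih'

theorem natCast_le_of_pow_lt {a : ℝ} {n : ℕ} (h : (3 / 2 : ℝ≥0∞) ^ n < 6 * ENNReal.ofReal a) :
    (n : ℝ) ≤ 15 * (1 + max 0 (Real.log a)) := by
  have ha : 0 < a := by
    by_contra ha
    simp [ENNReal.ofReal_of_nonpos (not_lt.1 ha)] at h
  have h' : (3 / 2 : ℝ) ^ n < 6 * a := by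
    rw [show (3 / 2 : ℝ≥0∞) = ENNReal.ofReal (3 / 2) by
        rw [ENNReal.ofReal_div_of_pos two_pos]; norm_num,
      show (6 : ℝ≥0∞) = ENNReal.ofReal 6 by norm_num, ← ENNReal.ofReal_mul (by norm_num),
      ← ENNReal.ofReal_pow (by norm_num)] at h
    exact (ENNReal.ofReal_lt_ofReal_iff (by positivity)).1 h
  have h1 := Real.log_lt_log (by positivity) h'
  rw [Real.log_pow, Real.log_mul (by norm_num) ha.ne'] at h1
  have h2 : (1 / 3 : ℝ) ≤ Real.log (3 / 2) := by
    have := Real.one_sub_inv_le_log_of_pos (x := 3 / 2) (by norm_num)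
    norm_num at this ⊢
    exact this
  have h3 : Real.log 6 ≤ 5 := by
    have := Real.log_le_sub_one_of_pos (x := 6) (by norm_num)
    norm_num at this
    exact this
  have h4 : (n : ℝ) * (1 / 3) ≤ n * Real.log (3 / 2) := by gcongr
  have h5 := le_max_left 0 (Real.log a)
  have h6 := le_max_right 0 (Real.log a)
  linarith

/-- The Orlicz-type integrand `a (1 + log⁺ a)`. -/
def llogl (a : ℝ) : ℝ≥0∞ :=
  ENNReal.ofReal a * ENNReal.ofReal (1 + max 0 (Real.log a))

theorem ofReal_le_llogl (a : ℝ) : ENNReal.ofReal a ≤ llogl a :=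
  le_mul_of_one_le_right' (by simp)

theorem mul_coeffSum_le_llogl {s : ℝ × ℝ} (c : (ℤ × ℤ) × (ℤ × ℤ) → ℝ≥0∞) {x : ℝ × ℝ}
    (a : ℝ) {W : ℝ≥0∞} (L : List ((ℤ × ℤ) × (ℤ × ℤ)))
    (hc : ∀ q ∈ L, x ∈ dyadicRect s q → c q ≤ 4 * W) :
    ENNReal.ofReal a * coeffSum s c L x ≤
      1 / 6 * coeffPowSum s c L x + 60 * (llogl a * W) := by
  set b := 15 * (1 + max 0 (Real.log a)) with hb
  have hb0 : 0 ≤ b := by positivity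
  refine (mul_coeffSum_le c (K := ⌊b⌋₊)
    (fun n hn => Nat.le_floor (natCast_le_of_pow_lt hn)) L hc).trans ?_
  gcongr 1 / 6 * coeffPowSum s c L x + ?_
  have hcast : ((min (overlap s L x) ⌊b⌋₊ : ℕ) : ℝ≥0∞) ≤ ENNReal.ofReal b := by
    rw [← ENNReal.ofReal_natCast]
    refine ENNReal.ofReal_le_ofReal (le_trans ?_ (Nat.floor_le hb0))
    exact_mod_cast min_le_right _ _
  calc _ ≤ 4 * W * ENNReal.ofReal a * ENNReal.ofReal b := by gcongr
    _ = _ := by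
      rw [hb, ENNReal.ofReal_mul (by norm_num), llogl,
        show ENNReal.ofReal 15 = 15 by norm_num]
      ring

theorem sum_coeff_mul_volume_le_llogl {s : ℝ × ℝ} (c : (ℤ × ℤ) × (ℤ × ℤ) → ℝ≥0∞)
    (g : ℝ × ℝ → ℝ) (W : ℝ × ℝ → ℝ≥0∞) {L : List ((ℤ × ℤ) × (ℤ × ℤ))}
    (hL : IsSparseList s L)
    (hg : ∀ q ∈ L, volume (dyadicRect s q) ≤ ∫⁻ x in dyadicRect s q, ENNReal.ofReal (g x))
    (hc : ∀ q ∈ L, ∀ x ∈ dyadicRect s q, c q ≤ 4 * W x) :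
    (L.map fun q => c q * volume (dyadicRect s q)).sum ≤ 120 * ∫⁻ x, llogl (g x) * W x := by
  set S := (L.map fun q => c q * volume (dyadicRect s q)).sum with hS
  set T := ∫⁻ x, llogl (g x) * W x with hT
  by_cases htop : ∃ q ∈ L, c q = ⊤
  · obtain ⟨q, hq, hcq⟩ := htop
    have hTtop : T = ⊤ := by
      refine top_unique ?_
      calc (⊤ : ℝ≥0∞) = volume (dyadicRect s q) * ⊤ :=
            (ENNReal.mul_top (volume_dyadicRect_ne_zero s q)).symm
        _ ≤ (∫⁻ x in dyadicRect s q, ENNReal.ofReal (g x)) * ⊤ := by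
            gcongr
            exact hg q hq
        _ ≤ ∫⁻ x in dyadicRect s q, ENNReal.ofReal (g x) * ⊤ := lintegral_mul_const_le _ _
        _ ≤ ∫⁻ x in dyadicRect s q, llogl (g x) * W x := by
            refine setLIntegral_mono' (measurableSet_dyadicRect s q) fun x hx => ?_
            have hW : W x = ⊤ := by
              have h := hc q hq x hx
              rw [hcq, top_le_iff] at h
              by_contra hne
              exact ENNReal.mul_ne_top (by norm_num) hne h
            rw [hW]
            gcongr
            exact ofReal_le_llogl _
        _ ≤ T := setLIntegral_le_lintegral _ _
    rw [hTtop]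
    simp
  · push Not at htop
    have hStop : S ≠ ⊤ := by
      rw [hS]
      clear_value S
      clear hS hL hg hc
      induction L with
      | nil => simp
      | cons p L ih =>
        rw [List.map_cons, List.sum_cons]
        exact ENNReal.add_ne_top.2 ⟨ENNReal.mul_ne_top (htop p (by simp))
          (volume_dyadicRect_ne_top s p), ih fun q hq => htop q (List.mem_cons_of_mem _ hq)⟩
    have hmain : S ≤ 1 / 6 * (3 * S) + 60 * T := by
      calc S ≤ ∫⁻ x, ENNReal.ofReal (g x) * coeffSum s c L x :=
            sum_coeff_mul_volume_le c _ L hg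
        _ ≤ ∫⁻ x, 1 / 6 * coeffPowSum s c L x + 60 * (llogl (g x) * W x) :=
            lintegral_mono fun x => mul_coeffSum_le_llogl c (g x) L fun q hq hx => hc q hq x hx
        _ = 1 / 6 * (∫⁻ x, coeffPowSum s c L x) + 60 * T := by
            rw [lintegral_add_left ((measurable_coeffPowSum s c L).const_mul _),
              lintegral_const_mul _ (measurable_coeffPowSum s c L),
              lintegral_const_mul' _ _ (by norm_num)]
        _ ≤ _ := by
            gcongr
            exact lintegral_coeffPowSum_le c hL
    rcases eq_or_ne T ⊤ with hTt | hTt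
    · rw [hTt]; simp
    clear_value S T
    lift S to NNReal using hStop
    lift T to NNReal using hTt
    have hmain' : S ≤ 1 / 6 * (3 * S) + 60 * T := by
      have h6 : (1 / 6 : ℝ≥0∞) = ((1 / 6 : NNReal) : ℝ≥0∞) := by
        rw [ENNReal.coe_div (by norm_num)]; norm_num
      rw [h6] at hmain
      exact_mod_cast hmain
    have : S ≤ 120 * T := by
      rw [← NNReal.coe_le_coe] at hmain' ⊢
      push_cast at hmain' ⊢
      linarith
    exact_mod_cast this

theorem setLIntegral_biUnion_list_le {ι α : Type*} [MeasurableSpace α] {μ : Measure α}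
    (L : List ι) (s : ι → Set α) (f : α → ℝ≥0∞) :
    ∫⁻ x in ⋃ q ∈ {q | q ∈ L}, s q, f x ∂μ ≤ (L.map fun q => ∫⁻ x in s q, f x ∂μ).sum := by
  induction L with
  | nil => simp
  | cons p L ih =>
    have : ⋃ q ∈ {q | q ∈ p :: L}, s q = s p ∪ ⋃ q ∈ {q | q ∈ L}, s q := by
      ext x
      simp
    rw [this, List.map_cons, List.sum_cons]
    exact (lintegral_union_le _ _ _).trans (add_le_add le_rfl ih)

theorem setLIntegral_wide_le {s : ℝ × ℝ} {w v W : ℝ × ℝ → ℝ≥0∞} (g : ℝ × ℝ → ℝ)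
    (hwv : ∀ q : (ℤ × ℤ) × (ℤ × ℤ), q.1.1 = q.2.1 → ∀ x ∈ dyadicRect s q,
      ∫⁻ y in dyadicRect s q, w y ≤ 4 * volume (dyadicRect s q) * v x)
    (hvW : ∀ q : (ℤ × ℤ) × (ℤ × ℤ), ∀ x ∈ dyadicRect s q,
      ∫⁻ y in dyadicRect s q, v y ≤ 4 * volume (dyadicRect s q) * W x)
    (l : List ((ℤ × ℤ) × (ℤ × ℤ))) (hwide : ∀ p ∈ l, p.2.1 ≤ p.1.1)
    (hg : ∀ p ∈ l, volume (dyadicRect s p) ≤ ∫⁻ x in dyadicRect s p, ENNReal.ofReal (g x)) :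
    ∫⁻ x in ⋃ p ∈ {p | p ∈ l}, dyadicRect s p, w x ≤ 960 * ∫⁻ x, llogl (g x) * W x := by
  classical
  let r : (ℤ × ℤ) × (ℤ × ℤ) → (ℤ × ℤ) × (ℤ × ℤ) → Prop := fun p q => p.1.1 ≤ q.1.1
  have : Std.Total r := ⟨fun p q => le_total p.1.1 q.1.1⟩
  have : IsTrans _ r := ⟨fun p q t h h' => le_trans (α := ℤ) h h'⟩
  obtain ⟨L, hL, hLl, hcov⟩ := exists_isSparseList s (l.insertionSort r)
    (List.pairwise_insertionSort r l)
  replace hLl : ∀ q ∈ L, q ∈ l := fun q hq => (List.mem_insertionSort r).1 (hLl hq)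
  replace hcov := fun p hp => hcov p ((List.mem_insertionSort r).2 hp)
  set E := ⋃ q ∈ {q | q ∈ L}, dyadicRect s q with hE
  have hEm : MeasurableSet E :=
    L.finite_toSet.measurableSet_biUnion fun q _ => measurableSet_dyadicRect s q
  have hsub : ⋃ p ∈ {p | p ∈ l}, dyadicRect s p ⊆
      ⋃ q ∈ {q : (ℤ × ℤ) × (ℤ × ℤ) | q.1.1 = q.2.1 ∧
        volume (dyadicRect s q) ≤ 2 * volume (dyadicRect s q ∩ E)}, dyadicRect s q := by
    refine iUnion₂_subset fun p hp x hx => ?_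
    let i : ℤ × ℤ := (p.2.1, ⌊(x.1 - s.1) / 2 ^ p.2.1⌋)
    have hxi : x.1 ∈ dyadicIco s.1 i := rfl
    refine mem_biUnion (x := (i, p.2)) ⟨rfl, ?_⟩ ⟨hxi, hx.2⟩
    calc volume (dyadicRect s (i, p.2))
        = volume (dyadicIco s.1 i) * volume (dyadicIco s.2 p.2) := volume_dyadicRect _ _
      _ ≤ volume (dyadicIco s.1 i) * (2 * volume (dyadicIco s.2 p.2 ∩ crossing s p L)) := by
          gcongr
          exact hcov p hp
      _ = 2 * volume (dyadicIco s.1 i ×ˢ (dyadicIco s.2 p.2 ∩ crossing s p L)) := by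
          rw [Measure.volume_eq_prod, Measure.prod_prod]; ring
      _ ≤ _ := by
          gcongr
          rintro y ⟨hy1, hy2, q, hq, hpq, hyq⟩
          exact ⟨⟨hy1, hy2⟩, mem_biUnion (x := q) hq
            ⟨hpq (dyadicIco_subset_of_mem (p := i) (q := p.1) (hwide p hp) hxi hx.1 hy1), hyq⟩⟩
  calc ∫⁻ x in ⋃ p ∈ {p | p ∈ l}, dyadicRect s p, w x
      ≤ 8 * ∫⁻ x in E, v x :=
        (lintegral_mono_set hsub).trans (setLIntegral_dyadicSquare_le hEm hwv)
    _ ≤ 8 * (L.map fun q => ∫⁻ x in dyadicRect s q, v x).sum := by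
        gcongr
        exact setLIntegral_biUnion_list_le L _ v
    _ = 8 * (L.map fun q => (∫⁻ x in dyadicRect s q, v x) / volume (dyadicRect s q) *
          volume (dyadicRect s q)).sum := by
        congr 3
        ext q
        rw [ENNReal.div_mul_cancel (volume_dyadicRect_ne_zero s q) (volume_dyadicRect_ne_top s q)]
    _ ≤ 8 * (120 * ∫⁻ x, llogl (g x) * W x) := by
        gcongr
        refine sum_coeff_mul_volume_le_llogl _ g W hL (fun q hq => hg q (hLl q hq))
          fun q hq x hx => ENNReal.div_le_of_le_mul ((hvW q x hx).trans (le_of_eq ?_))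
        ring
    _ = _ := by rw [← mul_assoc]; norm_num
theorem preimage_swap_dyadicRect (s : ℝ × ℝ) (p : (ℤ × ℤ) × (ℤ × ℤ)) :
    Prod.swap ⁻¹' dyadicRect s p = dyadicRect s.swap p.swap :=
  preimage_swap_prod _ _

theorem setLIntegral_preimage_swap (f : ℝ × ℝ → ℝ≥0∞) (A : Set (ℝ × ℝ)) :
    ∫⁻ x in Prod.swap ⁻¹' A, f x.swap = ∫⁻ x in A, f x :=
  MeasurePreserving.setLIntegral_comp_preimage_emb (Measure.measurePreserving_swap)
    MeasurableEquiv.prodComm.measurableEmbedding f A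

theorem setLIntegral_dyadicRect_swap (f : ℝ × ℝ → ℝ≥0∞) (s : ℝ × ℝ) (p : (ℤ × ℤ) × (ℤ × ℤ)) :
    ∫⁻ x in dyadicRect s.swap p, f x.swap = ∫⁻ x in dyadicRect s p.swap, f x := by
  rw [← setLIntegral_preimage_swap f, preimage_swap_dyadicRect, Prod.swap_swap]

theorem volume_dyadicRect_swap (s : ℝ × ℝ) (p : (ℤ × ℤ) × (ℤ × ℤ)) :
    volume (dyadicRect s.swap p) = volume (dyadicRect s p.swap) := by
  rw [volume_dyadicRect, volume_dyadicRect, mul_comm]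
  rfl

theorem setLIntegral_tall_le {s : ℝ × ℝ} {w v W : ℝ × ℝ → ℝ≥0∞} (g : ℝ × ℝ → ℝ)
    (hwv : ∀ q : (ℤ × ℤ) × (ℤ × ℤ), q.1.1 = q.2.1 → ∀ x ∈ dyadicRect s q,
      ∫⁻ y in dyadicRect s q, w y ≤ 4 * volume (dyadicRect s q) * v x)
    (hvW : ∀ q : (ℤ × ℤ) × (ℤ × ℤ), ∀ x ∈ dyadicRect s q,
      ∫⁻ y in dyadicRect s q, v y ≤ 4 * volume (dyadicRect s q) * W x)
    (l : List ((ℤ × ℤ) × (ℤ × ℤ))) (htall : ∀ p ∈ l, p.1.1 ≤ p.2.1)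
    (hg : ∀ p ∈ l, volume (dyadicRect s p) ≤ ∫⁻ x in dyadicRect s p, ENNReal.ofReal (g x)) :
    ∫⁻ x in ⋃ p ∈ {p | p ∈ l}, dyadicRect s p, w x ≤ 960 * ∫⁻ x, llogl (g x) * W x := by
  have hmem : ∀ {q : (ℤ × ℤ) × (ℤ × ℤ)} {x : ℝ × ℝ}, x ∈ dyadicRect s.swap q →
      x.swap ∈ dyadicRect s q.swap := fun hx => ⟨hx.2, hx.1⟩
  have h := setLIntegral_wide_le (s := s.swap) (w := fun x => w x.swap) (v := fun x => v x.swap)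
    (W := fun x => W x.swap) (fun x => g x.swap)
    (fun q hq x hx => by
      rw [setLIntegral_dyadicRect_swap, volume_dyadicRect_swap]
      exact hwv q.swap hq.symm x.swap (hmem hx))
    (fun q x hx => by
      rw [setLIntegral_dyadicRect_swap, volume_dyadicRect_swap]
      exact hvW q.swap x.swap (hmem hx))
    (l.map Prod.swap)
    (by
      intro p hp
      obtain ⟨q, hq, rfl⟩ := List.mem_map.1 hp
      exact htall q hq)
    (by
      intro p hp
      obtain ⟨q, hq, rfl⟩ := List.mem_map.1 hp
      rw [setLIntegral_dyadicRect_swap (fun x => ENNReal.ofReal (g x)), volume_dyadicRect_swap,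
        Prod.swap_swap]
      exact hg q hq)
  have hset : ⋃ p ∈ {p | p ∈ l.map Prod.swap}, dyadicRect s.swap p =
      Prod.swap ⁻¹' ⋃ p ∈ {p | p ∈ l}, dyadicRect s p := by
    simp_rw [preimage_iUnion, preimage_swap_dyadicRect]
    ext x
    simp only [mem_iUnion, exists_prop, mem_ofPred_eq, List.mem_map]
    constructor
    · rintro ⟨_, ⟨q, hq, rfl⟩, hx⟩
      exact ⟨q, hq, hx⟩
    · rintro ⟨q, hq, hx⟩
      exact ⟨_, ⟨q, hq, rfl⟩, hx⟩
  have huniv := setLIntegral_preimage_swap (fun x => llogl (g x) * W x) univ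
  rw [preimage_univ, setLIntegral_univ, setLIntegral_univ] at huniv
  rwa [hset, setLIntegral_preimage_swap, huniv] at h

theorem setLIntegral_dyadicRect_le {s : ℝ × ℝ} {w v W : ℝ × ℝ → ℝ≥0∞} (g : ℝ × ℝ → ℝ)
    (hwv : ∀ q : (ℤ × ℤ) × (ℤ × ℤ), q.1.1 = q.2.1 → ∀ x ∈ dyadicRect s q,
      ∫⁻ y in dyadicRect s q, w y ≤ 4 * volume (dyadicRect s q) * v x)
    (hvW : ∀ q : (ℤ × ℤ) × (ℤ × ℤ), ∀ x ∈ dyadicRect s q,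
      ∫⁻ y in dyadicRect s q, v y ≤ 4 * volume (dyadicRect s q) * W x)
    (l : List ((ℤ × ℤ) × (ℤ × ℤ)))
    (hg : ∀ p ∈ l, volume (dyadicRect s p) ≤ ∫⁻ x in dyadicRect s p, ENNReal.ofReal (g x)) :
    ∫⁻ x in ⋃ p ∈ {p | p ∈ l}, dyadicRect s p, w x ≤ 1920 * ∫⁻ x, llogl (g x) * W x := by
  set l₁ := l.filter fun p => p.2.1 ≤ p.1.1 with hl₁
  set l₂ := l.filter fun p => p.1.1 ≤ p.2.1 with hl₂
  have hsub : ⋃ p ∈ {p | p ∈ l}, dyadicRect s p ⊆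
      (⋃ p ∈ {p | p ∈ l₁}, dyadicRect s p) ∪ ⋃ p ∈ {p | p ∈ l₂}, dyadicRect s p := by
    refine iUnion₂_subset fun p hp x hx => ?_
    rcases le_total p.2.1 p.1.1 with h | h
    · exact Or.inl (mem_biUnion (x := p) (List.mem_filter.2 ⟨hp, by simpa using h⟩) hx)
    · exact Or.inr (mem_biUnion (x := p) (List.mem_filter.2 ⟨hp, by simpa using h⟩) hx)
  refine (lintegral_mono_set hsub).trans ((lintegral_union_le _ _ _).trans ?_)
  have h₁ := setLIntegral_wide_le g hwv hvW l₁
    (fun p hp => by simpa using (List.mem_filter.1 hp).2) fun p hp => hg p (List.mem_filter.1 hp).1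
  have h₂ := setLIntegral_tall_le g hwv hvW l₂
    (fun p hp => by simpa using (List.mem_filter.1 hp).2) fun p hp => hg p (List.mem_filter.1 hp).1
  refine (add_le_add h₁ h₂).trans (le_of_eq ?_)
  rw [← add_mul]
  norm_num

theorem dyadicIco_subset_Ioo (s : ℝ) (p : ℤ × ℤ) :
    ∃ a : ℝ, dyadicIco s p ⊆ Ioo a (a + 2 * 2 ^ p.1) := by
  have h2 : (0 : ℝ) < 2 ^ p.1 := by positivity
  refine ⟨s + p.2 * 2 ^ p.1 - 2 ^ p.1, ?_⟩
  rw [dyadicIco_eq]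
  rintro y ⟨h, h'⟩
  constructor <;> linarith

theorem exists_Ioo_prod_Ioo_superset (s : ℝ × ℝ) (p : (ℤ × ℤ) × (ℤ × ℤ)) :
    ∃ a b : ℝ,
      dyadicRect s p ⊆ Ioo a (a + 2 * 2 ^ p.1.1) ×ˢ Ioo b (b + 2 * 2 ^ p.2.1) ∧
      volume (Ioo a (a + 2 * 2 ^ p.1.1) ×ˢ Ioo b (b + 2 * 2 ^ p.2.1)) =
        4 * volume (dyadicRect s p) := by
  obtain ⟨a, ha⟩ := dyadicIco_subset_Ioo s.1 p.1
  obtain ⟨b, hb⟩ := dyadicIco_subset_Ioo s.2 p.2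
  refine ⟨a, b, prod_mono ha hb, ?_⟩
  rw [volume_dyadicRect, volume_dyadicIco, volume_dyadicIco, Measure.volume_eq_prod,
    Measure.prod_prod, Real.volume_Ioo, Real.volume_Ioo, add_sub_cancel_left, add_sub_cancel_left,
    ENNReal.ofReal_mul zero_le_two, ENNReal.ofReal_mul zero_le_two, ENNReal.ofReal_ofNat]
  ring

theorem setLIntegral_le_mul_of_div_le {f : ℝ × ℝ → ℝ≥0∞} {A B : Set (ℝ × ℝ)} {m M : ℝ≥0∞}
    (hAB : A ⊆ B) (hB : volume B = 4 * m) (hm : m ≠ 0) (hm' : m ≠ ⊤)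
    (h : (∫⁻ y in B, f y) / volume B ≤ M) : ∫⁻ y in A, f y ≤ 4 * m * M := by
  refine (lintegral_mono_set hAB).trans ?_
  rw [ENNReal.div_le_iff (by simp [hB, hm]) (by rw [hB]; finiteness)] at h
  rwa [← hB, mul_comm]

theorem setLIntegral_le_mul_MHL2 {w : ℝ × ℝ → ℝ} (hw : ∀ x, 0 ≤ w x) (s : ℝ × ℝ)
    (q : (ℤ × ℤ) × (ℤ × ℤ)) (hq : q.1.1 = q.2.1) (x : ℝ × ℝ) (hx : x ∈ dyadicRect s q) :
    ∫⁻ y in dyadicRect s q, ENNReal.ofReal (w y) ≤ 4 * volume (dyadicRect s q) * MHL2 w x := by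
  obtain ⟨a, b, hsub, hvol⟩ := exists_Ioo_prod_Ioo_superset s q
  refine setLIntegral_le_mul_of_div_le hsub hvol (volume_dyadicRect_ne_zero s q)
    (volume_dyadicRect_ne_top s q) ?_
  have hcube : IsCube2 (Ioo a (a + 2 * 2 ^ q.1.1) ×ˢ Ioo b (b + 2 * 2 ^ q.2.1)) :=
    ⟨a, b, 2 * 2 ^ q.1.1, by positivity, by rw [hq]⟩
  have h := le_iSup₂ (f := fun (Q : Set (ℝ × ℝ)) (_ : IsCube2 Q ∧ x ∈ Q) =>
    (∫⁻ y in Q, ENNReal.ofReal |w y|) / volume Q) _ ⟨hcube, hsub hx⟩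
  simpa only [MHL2, abs_of_nonneg (hw _)] using h

theorem setLIntegral_le_mul_MR2e (v : ℝ × ℝ → ℝ≥0∞) (s : ℝ × ℝ)
    (q : (ℤ × ℤ) × (ℤ × ℤ)) (x : ℝ × ℝ) (hx : x ∈ dyadicRect s q) :
    ∫⁻ y in dyadicRect s q, v y ≤ 4 * volume (dyadicRect s q) * MR2e v x := by
  obtain ⟨a, b, hsub, hvol⟩ := exists_Ioo_prod_Ioo_superset s q
  refine setLIntegral_le_mul_of_div_le hsub hvol (volume_dyadicRect_ne_zero s q)
    (volume_dyadicRect_ne_top s q) ?_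
  have hrect : IsRect2 (Ioo a (a + 2 * 2 ^ q.1.1) ×ˢ Ioo b (b + 2 * 2 ^ q.2.1)) :=
    ⟨a, _, b, _, lt_add_of_pos_right a (by positivity), lt_add_of_pos_right b (by positivity), rfl⟩
  exact le_iSup₂ (f := fun (R : Set (ℝ × ℝ)) (_ : IsRect2 R ∧ x ∈ R) =>
    (∫⁻ y in R, v y) / volume R) _ ⟨hrect, hsub hx⟩

theorem Ioo_subset_dyadicIco_or {a b s : ℝ} {k : ℤ} :
    Ioo a b ⊆ dyadicIco s (k, ⌊(a - s) / 2 ^ k⌋) ∨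
      s + (⌊(a - s) / 2 ^ k⌋ + 1) * 2 ^ k ∈ Ioo a b := by
  have h2 : (0 : ℝ) < 2 ^ k := by positivity
  set m := ⌊(a - s) / 2 ^ k⌋ with hm
  obtain ⟨h1, h1'⟩ := Int.floor_eq_iff.1 hm.symm
  rw [le_div_iff₀ h2] at h1
  rw [div_lt_iff₀ h2] at h1'
  rcases le_or_gt b (s + (m + 1) * 2 ^ k) with h | h
  · left
    rw [dyadicIco_eq]
    rintro y ⟨hy, hy'⟩
    constructor <;> simp only <;> linarith
  · exact Or.inr ⟨by linarith, h⟩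

/-- The one-third trick: an interval is contained in a comparable dyadic interval of one of two
grids. -/
theorem exists_Ioo_subset_dyadicIco {a b : ℝ} {k N : ℤ} (hab : 3 * (b - a) ≤ 2 ^ k)
    (hkN : k ≤ N) :
    ∃ s : ℝ, (s = 0 ∨ s = 2 ^ N / 3) ∧ ∃ m : ℤ, Ioo a b ⊆ dyadicIco s (k, m) := by
  have h2 : (0 : ℝ) < 2 ^ k := by positivity
  rcases Ioo_subset_dyadicIco_or (a := a) (b := b) (s := 0) (k := k) with h | h
  · exact ⟨0, Or.inl rfl, _, h⟩
  rcases Ioo_subset_dyadicIco_or (a := a) (b := b) (s := 2 ^ N / 3) (k := k) with h' | h'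
  · exact ⟨_, Or.inr rfl, _, h'⟩
  exfalso
  set m := ⌊(a - 0) / 2 ^ k⌋
  set m' := ⌊(a - 2 ^ N / 3) / 2 ^ k⌋
  obtain ⟨n, rfl⟩ := Int.le.dest hkN
  rw [zpow_add₀ two_ne_zero, zpow_natCast] at h'
  have h3 : |(2 : ℝ) ^ n + 3 * (m' - m)| < 1 := by
    rw [abs_lt]
    constructor
    · have : -1 * (2 : ℝ) ^ k < (2 ^ n + 3 * (m' - m)) * 2 ^ k := by
        linarith [h.1, h.2, h'.1, h'.2]
      exact lt_of_mul_lt_mul_right this h2.le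
    · have : ((2 : ℝ) ^ n + 3 * (m' - m)) * 2 ^ k < 1 * 2 ^ k := by
        linarith [h.1, h.2, h'.1, h'.2]
      exact lt_of_mul_lt_mul_right this h2.le
  have h4 : |(2 : ℤ) ^ n + 3 * (m' - m)| < 1 := by exact_mod_cast h3
  have h5 : (3 : ℤ) ∣ 2 ^ n := ⟨m - m', by linarith [Int.abs_lt_one_iff.1 h4]⟩
  have h6 : (3 : ℤ) ∣ 2 := Int.prime_three.dvd_of_dvd_pow h5
  norm_num at h6

theorem exists_zpow_two_mem_Icc {r : ℝ} (hr : 0 < r) :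
    ∃ k : ℤ, 3 * r ≤ 2 ^ k ∧ (2 : ℝ) ^ k ≤ 6 * r := by
  obtain ⟨n, h1, h2⟩ := exists_mem_Ico_zpow (x := 3 * r) (y := (2 : ℝ)) (by positivity) one_lt_two
  refine ⟨n + 1, h2.le, ?_⟩
  rw [zpow_add_one₀ two_ne_zero]
  linarith

/-- The translations of the four dyadic grids attached to the largest generation `N`. -/
def gridShifts (N : ℤ) : List (ℝ × ℝ) :=
  [(0, 0), (0, 2 ^ N / 3), (2 ^ N / 3, 0), (2 ^ N / 3, 2 ^ N / 3)]

theorem IsRect2.exists_subset_dyadicRect {R : Set (ℝ × ℝ)} (hR : IsRect2 R) :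
    ∃ N₀ : ℤ, ∀ N, N₀ ≤ N → ∃ s ∈ gridShifts N, ∃ p,
      R ⊆ dyadicRect s p ∧ volume (dyadicRect s p) ≤ 36 * volume R := by
  obtain ⟨a₁, b₁, a₂, b₂, h₁, h₂, rfl⟩ := hR
  obtain ⟨k₁, hk₁, hk₁'⟩ := exists_zpow_two_mem_Icc (sub_pos.2 h₁)
  obtain ⟨k₂, hk₂, hk₂'⟩ := exists_zpow_two_mem_Icc (sub_pos.2 h₂)
  refine ⟨max k₁ k₂, fun N hN => ?_⟩
  obtain ⟨s₁, hs₁, m₁, hm₁⟩ := exists_Ioo_subset_dyadicIco hk₁ ((le_max_left _ _).trans hN)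
  obtain ⟨s₂, hs₂, m₂, hm₂⟩ := exists_Ioo_subset_dyadicIco hk₂ ((le_max_right _ _).trans hN)
  refine ⟨(s₁, s₂), ?_, ((k₁, m₁), (k₂, m₂)), prod_mono hm₁ hm₂, ?_⟩
  · rcases hs₁ with rfl | rfl <;> rcases hs₂ with rfl | rfl <;> simp [gridShifts]
  · rw [volume_dyadicRect, volume_dyadicIco, volume_dyadicIco, Measure.volume_eq_prod,
      Measure.prod_prod, Real.volume_Ioo, Real.volume_Ioo]
    calc _ ≤ ENNReal.ofReal (6 * (b₁ - a₁)) * ENNReal.ofReal (6 * (b₂ - a₂)) := by gcongr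
      _ = _ := by
        rw [ENNReal.ofReal_mul (by norm_num), ENNReal.ofReal_mul (by norm_num),
          show ENNReal.ofReal 6 = 6 by norm_num, show (36 : ℝ≥0∞) = 6 * 6 by norm_num]
        ring

theorem setLIntegral_biUnion_rect_le {w v W : ℝ × ℝ → ℝ≥0∞} (g : ℝ × ℝ → ℝ)
    (hwv : ∀ (s : ℝ × ℝ) (q : (ℤ × ℤ) × (ℤ × ℤ)), q.1.1 = q.2.1 → ∀ x ∈ dyadicRect s q,
      ∫⁻ y in dyadicRect s q, w y ≤ 4 * volume (dyadicRect s q) * v x)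
    (hvW : ∀ (s : ℝ × ℝ) (q : (ℤ × ℤ) × (ℤ × ℤ)), ∀ x ∈ dyadicRect s q,
      ∫⁻ y in dyadicRect s q, v y ≤ 4 * volume (dyadicRect s q) * W x)
    (F : Finset (Set (ℝ × ℝ))) (hF : ∀ R ∈ F, IsRect2 R)
    (hg : ∀ R ∈ F, 36 * volume R ≤ ∫⁻ x in R, ENNReal.ofReal (g x)) :
    ∫⁻ x in ⋃ R ∈ F, R, w x ≤ 7680 * ∫⁻ x, llogl (g x) * W x := by
  classical
  choose! N₀ hN₀ using fun R hR => (hF R hR).exists_subset_dyadicRect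
  obtain ⟨N, hN⟩ := (F.image N₀).exists_le
  choose! s hs p hRp hvol using fun R hR => hN₀ R hR N (hN _ (Finset.mem_image_of_mem _ hR))
  let l : ℝ × ℝ → List ((ℤ × ℤ) × (ℤ × ℤ)) := fun σ => (F.toList.filter (s · = σ)).map p
  have hsub : ⋃ R ∈ F, R ⊆
      ⋃ σ ∈ {σ | σ ∈ gridShifts N}, ⋃ q ∈ {q | q ∈ l σ}, dyadicRect σ q := by
    refine iUnion₂_subset fun R hR x hx => ?_
    refine mem_biUnion (x := s R) (hs R hR) (mem_biUnion (x := p R) ?_ (hRp R hR hx))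
    exact List.mem_map_of_mem (List.mem_filter.2 ⟨Finset.mem_toList.2 hR, by simp⟩)
  have hσ : ∀ σ, ∫⁻ x in ⋃ q ∈ {q | q ∈ l σ}, dyadicRect σ q, w x ≤
      1920 * ∫⁻ x, llogl (g x) * W x := by
    refine fun σ => setLIntegral_dyadicRect_le g (hwv σ) (hvW σ) (l σ) fun q hq => ?_
    obtain ⟨R, hR, rfl⟩ := List.mem_map.1 hq
    rw [List.mem_filter, Finset.mem_toList, decide_eq_true_eq] at hR
    obtain ⟨hR, rfl⟩ := hR
    exact (hvol R hR).trans ((hg R hR).trans (lintegral_mono_set (hRp R hR)))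
  refine (lintegral_mono_set hsub).trans ((setLIntegral_biUnion_list_le _ _ w).trans ?_)
  refine (List.sum_le_card_nsmul _ (1920 * ∫⁻ x, llogl (g x) * W x) fun y hy => ?_).trans
    (le_of_eq ?_)
  · obtain ⟨σ, -, rfl⟩ := List.mem_map.1 hy
    exact hσ σ
  · rw [List.length_map, nsmul_eq_mul, ← mul_assoc]
    norm_num [gridShifts]

theorem llogl_mul_le {a : ℝ} (ha : 0 ≤ a) : llogl (36 * a) ≤ 1296 * llogl a := by
  rcases ha.eq_or_lt with rfl | ha
  · simp [llogl]
  have h36 : Real.log 36 ≤ 35 := by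
    have := Real.log_le_sub_one_of_pos (x := 36) (by norm_num)
    norm_num at this
    exact this
  have h1 : 1 + max 0 (Real.log (36 * a)) ≤ 36 * (1 + max 0 (Real.log a)) := by
    rw [Real.log_mul (by norm_num) ha.ne']
    have h5 := le_max_left 0 (Real.log a)
    have h6 := le_max_right 0 (Real.log a)
    have : max 0 (Real.log 36 + Real.log a) ≤ 35 + max 0 (Real.log a) :=
      max_le (by linarith) (by linarith)
    linarith
  rw [llogl, llogl]
  calc _ ≤ ENNReal.ofReal (36 * a) * ENNReal.ofReal (36 * (1 + max 0 (Real.log a))) := by gcongr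
    _ = _ := by
      rw [ENNReal.ofReal_mul (by norm_num), ENNReal.ofReal_mul (by norm_num),
        show ENNReal.ofReal 36 = 36 by norm_num, show (1296 : ℝ≥0∞) = 36 * 36 by norm_num]
      ring

theorem setOf_lt_MR2_eq (f : ℝ × ℝ → ℝ) (t : ℝ≥0∞) :
    {x | t < MR2 f x} = ⋃ R ∈ {R : Set (ℝ × ℝ) | IsRect2 R ∧
      t < (∫⁻ y in R, ENNReal.ofReal |f y|) / volume R}, R := by
  ext x
  simp only [MR2, lt_iSup_iff, mem_ofPred_eq, mem_iUnion, exists_prop]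
  exact exists_congr fun R => by tauto

/-- Endpoint Fefferman–Stein inequality for the strong maximal operator in the
plane, with iterated majorant `W = M_R M_Q w`. -/
theorem strong_maximal_endpoint_FS :
    ∃ C : ℝ, 0 < C ∧
      ∀ (w f : ℝ × ℝ → ℝ), (∀ x, 0 ≤ w x) → LocallyIntegrable w volume →
        LocallyIntegrable f volume → ∀ t : ℝ, 0 < t →
          (∫⁻ x in {x | ENNReal.ofReal t < MR2 f x}, ENNReal.ofReal (w x)) ≤
            ENNReal.ofReal C *
              ∫⁻ x, ENNReal.ofReal (|f x| / t) *
                ENNReal.ofReal (1 + max 0 (Real.log (|f x| / t))) *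
                  MR2e (MHL2 w) x := by
  refine ⟨7680 * 1296, by norm_num, fun w f hw _ _ t ht => ?_⟩
  rw [setOf_lt_MR2_eq]
  obtain ⟨T, hT, hTc, hTU⟩ := TopologicalSpace.isOpen_biUnion_countable
    {R : Set (ℝ × ℝ) | IsRect2 R ∧
      ENNReal.ofReal t < (∫⁻ y in R, ENNReal.ofReal |f y|) / volume R} id
    (by
      rintro R ⟨⟨a₁, b₁, a₂, b₂, -, -, rfl⟩, -⟩
      exact isOpen_Ioo.prod isOpen_Ioo)
  simp only [id_eq] at hTU
  rw [← hTU]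
  refine setLIntegral_biUnion_le_of_finset hTc (fun R => R) _ _ fun F hF => ?_
  have hg : ∀ R ∈ F, 36 * volume R ≤ ∫⁻ x in R, ENNReal.ofReal (36 * (|f x| / t)) := by
    intro R hR
    have h36 : ∀ x, ENNReal.ofReal (36 * (|f x| / t)) =
        ENNReal.ofReal (36 / t) * ENNReal.ofReal |f x| := fun x => by
      rw [← ENNReal.ofReal_mul (by positivity)]
      congr 1
      ring
    simp_rw [h36]
    rw [lintegral_const_mul' _ _ ENNReal.ofReal_ne_top]
    calc 36 * volume R = ENNReal.ofReal (36 / t) * (ENNReal.ofReal t * volume R) := by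
          rw [← mul_assoc, ← ENNReal.ofReal_mul (by positivity), div_mul_cancel₀ _ ht.ne']
          norm_num
      _ ≤ _ := by
          gcongr
          exact ENNReal.mul_le_of_le_div (hT (hF hR)).2.le
  calc _ ≤ 7680 * ∫⁻ x, llogl (36 * (|f x| / t)) * MR2e (MHL2 w) x :=
        setLIntegral_biUnion_rect_le _ (setLIntegral_le_mul_MHL2 hw)
          (setLIntegral_le_mul_MR2e (MHL2 w)) F (fun R hR => (hT (hF hR)).1) hg
    _ ≤ 7680 * ∫⁻ x, 1296 * (llogl (|f x| / t) * MR2e (MHL2 w) x) := by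
        gcongr 7680 * ?_
        refine lintegral_mono fun x => ?_
        rw [← mul_assoc]
        gcongr
        exact llogl_mul_le (by positivity)
    _ = _ := by
        rw [lintegral_const_mul' _ _ (by norm_num), ← mul_assoc, ENNReal.ofReal_mul (by norm_num)]
        norm_num [llogl]
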